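/- arXiv:2511.11226 — 3 statements merged into one kernel-verified Lean document; each statement's English description precedes it below -/
import Mathlib

section
/- Hopf's inequality: Let V, W, U be vector spaces over ℂ with V and W finite-dimensional and nonzero, and let φ : V × W → U be a ℂ-bilinear map with no zero-divisors, i.e. φ(v,w) = 0 implies v = 0 or w = 0. Then the ℂ-linear span of the image of φ has dimension at least dim V + dim W − 1. -/
section Segre

open MvPolynomial

variable {ι κ : Type*}

open Classical in
/-- The endomorphism of a polynomial ring sending the variables in `s` to zero. -/
noncomputable def killVars {σ : Type*} (s : Set σ) :
    MvPolynomial σ ℂ →ₐ[ℂ] MvPolynomial σ ℂ :=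
  aeval fun a => if a ∈ s then 0 else X a

lemma killVars_X_of_mem {σ : Type*} {s : Set σ} {a : σ} (h : a ∈ s) :
    killVars s (X a) = 0 := by
  simp [killVars, h]

lemma killVars_X_of_notMem {σ : Type*} {s : Set σ} {a : σ} (h : a ∉ s) :
    killVars s (X a) = X a := by
  simp [killVars, h]

lemma killVars_comp_of_subset {σ : Type*} {s t : Set σ} (h : s ⊆ t) :
    (killVars t).comp (killVars s) = killVars t := by
  ext1 a
  by_cases hs : a ∈ s
  · simp [killVars_X_of_mem hs, killVars_X_of_mem (h hs)]
  · simp [killVars_X_of_notMem hs]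

variable (ι κ) in
/-- The polynomial parametrization of rank-one matrices. -/
noncomputable def segreHom : MvPolynomial (ι × κ) ℂ →ₐ[ℂ] MvPolynomial (ι ⊕ κ) ℂ :=
  aeval fun p => X (Sum.inl p.1) * X (Sum.inr p.2)

@[simp]
lemma segreHom_X (p : ι × κ) :
    segreHom ι κ (X p) = X (Sum.inl p.1) * X (Sum.inr p.2) := by
  simp [segreHom]

/-- The prime ideal of the Segre algebra cut out by the vanishing of the variables in `s`. -/
noncomputable def segreIdeal (s : Set (ι ⊕ κ)) : Ideal (segreHom ι κ).range :=
  RingHom.ker ((killVars s).comp (segreHom ι κ).range.val)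

instance (s : Set (ι ⊕ κ)) : (segreIdeal s).IsPrime :=
  RingHom.ker_isPrime _

lemma mem_segreIdeal {s : Set (ι ⊕ κ)} {a : (segreHom ι κ).range} :
    a ∈ segreIdeal s ↔ killVars s (a : MvPolynomial (ι ⊕ κ) ℂ) = 0 :=
  Iff.rfl

lemma segreIdeal_mono {s t : Set (ι ⊕ κ)} (h : s ⊆ t) : segreIdeal s ≤ segreIdeal t := by
  intro a ha
  rw [mem_segreIdeal] at ha ⊢
  rw [← killVars_comp_of_subset h, AlgHom.comp_apply, ha, map_zero]

lemma segreIdeal_lt {s t : Set (ι ⊕ κ)} (h : s ⊆ t) {i : ι} {j : κ}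
    (hi : Sum.inl i ∉ s) (hj : Sum.inr j ∉ s) (ht : Sum.inl i ∈ t ∨ Sum.inr j ∈ t) :
    segreIdeal s < segreIdeal t := by
  refine lt_of_le_not_ge (segreIdeal_mono h) fun hle => ?_
  have hmem : (segreHom ι κ).rangeRestrict (X (i, j)) ∈ segreIdeal t := by
    rw [mem_segreIdeal]
    rcases ht with ht | ht <;> simp [killVars_X_of_mem ht]
  have := hle hmem
  rw [mem_segreIdeal] at this
  simp [killVars_X_of_notMem hi, killVars_X_of_notMem hj] at this

lemma card_le_height_segreIdeal (i : ι) (j : κ) (s : Finset (ι ⊕ κ))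
    (hi : Sum.inl i ∉ s) (hj : Sum.inr j ∉ s) :
    (s.card : ℕ∞) ≤ (segreIdeal (s : Set (ι ⊕ κ))).height := by
  classical
  induction s using Finset.induction_on with
  | empty => simp
  | insert a s ha ih =>
    simp only [Finset.mem_insert, not_or] at hi hj
    have hlt : segreIdeal (s : Set (ι ⊕ κ)) <
        segreIdeal ((insert a s : Finset (ι ⊕ κ)) : Set (ι ⊕ κ)) := by
      rcases a with a | a
      · exact segreIdeal_lt (i := a) (j := j) (by simp) (by simpa) (by simpa using hj.2)
          (by simp)
      · exact segreIdeal_lt (i := i) (j := a) (by simp) (by simpa using hi.2) (by simpa)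
          (by simp)
    rw [Finset.card_insert_of_notMem ha, Nat.cast_add, Nat.cast_one]
    exact (add_le_add_left (ih hi.2 hj.2) 1).trans (Ideal.height_add_one_le_of_lt_of_isPrime hlt)

lemma card_add_card_le_height_segreIdeal_univ [Fintype ι] [Fintype κ] [Nonempty ι]
    [Nonempty κ] :
    ((Fintype.card ι + Fintype.card κ - 1 : ℕ) : ℕ∞) ≤
      (segreIdeal (Set.univ : Set (ι ⊕ κ))).height := by
  classical
  obtain ⟨i⟩ := ‹Nonempty ι›
  obtain ⟨j⟩ := ‹Nonempty κ›
  let s : Finset (ι ⊕ κ) := Finset.univ \ {Sum.inl i, Sum.inr j}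
  have hi : Sum.inl i ∉ s := by simp [s]
  have hj : Sum.inr j ∉ s := by simp [s]
  have hs : s.card = Fintype.card ι + Fintype.card κ - 2 := by
    rw [Finset.card_sdiff_of_subset (Finset.subset_univ _), Finset.card_pair (by simp),
      Finset.card_univ, Fintype.card_sum]
  have hlt : segreIdeal (s : Set (ι ⊕ κ)) < segreIdeal Set.univ :=
    segreIdeal_lt (i := i) (j := j) (Set.subset_univ _) (by simpa using hi) (by simpa using hj)
      (by simp)
  have hι : 0 < Fintype.card ι := Fintype.card_pos_iff.mpr ⟨i⟩
  have hκ : 0 < Fintype.card κ := Fintype.card_pos_iff.mpr ⟨j⟩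
  rw [show Fintype.card ι + Fintype.card κ - 1 = s.card + 1 by omega, Nat.cast_add, Nat.cast_one]
  exact (add_le_add_left (card_le_height_segreIdeal i j s hi hj) 1).trans
    (Ideal.height_add_one_le_of_lt_of_isPrime hlt)

lemma coe_rangeRestrict_segreHom (p : MvPolynomial (ι × κ) ℂ) :
    ((segreHom ι κ).rangeRestrict p : MvPolynomial (ι ⊕ κ) ℂ) = segreHom ι κ p :=
  rfl

lemma mem_segreIdeal_univ {p : MvPolynomial (ι × κ) ℂ} :
    (segreHom ι κ).rangeRestrict p ∈ segreIdeal Set.univ ↔ aeval (0 : ι × κ → ℂ) p = 0 := by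
  have h : (killVars Set.univ).comp (segreHom ι κ) =
      (Algebra.ofId ℂ (MvPolynomial (ι ⊕ κ) ℂ)).comp (aeval (0 : ι × κ → ℂ)) := by
    ext1 a
    simp [killVars_X_of_mem]
  have hp := DFunLike.congr_fun h p
  simp only [AlgHom.comp_apply] at hp
  rw [mem_segreIdeal, coe_rangeRestrict_segreHom, hp, Algebra.ofId_apply,
    FaithfulSMul.algebraMap_eq_zero_iff]

/-- A matrix all of whose `2 × 2` minors vanish is an outer product. -/
lemma exists_eq_mul_of_minors_eq_zero {x : ι × κ → ℂ}
    (hx : ∀ i j k l, x (i, j) * x (k, l) = x (i, l) * x (k, j)) :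
    ∃ (v : ι → ℂ) (w : κ → ℂ), ∀ i j, x (i, j) = v i * w j := by
  by_cases h : ∃ p, x p ≠ 0
  · obtain ⟨⟨k, l⟩, hkl⟩ := h
    refine ⟨fun i => x (i, l), fun j => x (k, j) / x (k, l), fun i j => ?_⟩
    field_simp
    exact hx i j k l
  · push Not at h
    exact ⟨0, 0, fun i j => by simp [h]⟩

lemma segreIdeal_univ_mem_minimalPrimes [Fintype ι] [Fintype κ] {ρ : Type*}
    (c : ρ → ι × κ → ℂ)
    (hc : ∀ (v : ι → ℂ) (w : κ → ℂ),
      (∀ k, ∑ p : ι × κ, c k p * (v p.1 * w p.2) = 0) → v = 0 ∨ w = 0) :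
    segreIdeal (Set.univ : Set (ι ⊕ κ)) ∈ (Ideal.span (Set.range fun k =>
      (segreHom ι κ).rangeRestrict (∑ p, C (c k p) * X p))).minimalPrimes := by
  refine ⟨⟨inferInstance, Ideal.span_le.mpr ?_⟩, ?_⟩
  · rintro _ ⟨k, rfl⟩
    exact mem_segreIdeal_univ.mpr (by simp)
  rintro J ⟨hJ, hfJ⟩ -
  let π : MvPolynomial (ι × κ) ℂ →+* (segreHom ι κ).range := (segreHom ι κ).rangeRestrict
  have hzero : ∀ x ∈ zeroLocus ℂ (J.comap π), x = 0 := by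
    intro x hx
    obtain ⟨v, w, hvw⟩ := exists_eq_mul_of_minors_eq_zero (x := x) fun i j k l => by
      have hmem : X (i, j) * X (k, l) - X (i, l) * X (k, j) ∈ J.comap π := by
        have : π (X (i, j) * X (k, l) - X (i, l) * X (k, j)) = 0 := by
          apply Subtype.ext
          change segreHom ι κ (X (i, j) * X (k, l) - X (i, l) * X (k, j)) = 0
          simp only [map_sub, map_mul, segreHom_X]
          ring
        rw [Ideal.mem_comap, this]
        exact J.zero_mem
      simpa [sub_eq_zero] using hx _ hmem
    have hf : ∀ k, ∑ p : ι × κ, c k p * (v p.1 * w p.2) = 0 := fun k => by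
      have hmem : (∑ p, C (c k p) * X p) ∈ J.comap π :=
        hfJ (Ideal.subset_span ⟨k, rfl⟩)
      simpa [← hvw] using hx _ hmem
    ext ⟨i, j⟩
    rcases hc v w hf with h | h <;> simp [hvw, h]
  intro a ha
  obtain ⟨p, rfl⟩ := (segreHom ι κ).rangeRestrict_surjective a
  rw [mem_segreIdeal_univ] at ha
  have hp : p ∈ vanishingIdeal ℂ (zeroLocus ℂ (J.comap π)) := fun x hx => by
    rw [hzero x hx, ha]
  rwa [IsPrime.vanishingIdeal_zeroLocus] at hp

/-- Hopf's inequality in coordinates. -/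
lemma card_add_card_sub_one_le_of_forall_eq_zero [Fintype ι] [Fintype κ] [Nonempty ι]
    [Nonempty κ] {ρ : Type*} [Fintype ρ] (c : ρ → ι × κ → ℂ)
    (hc : ∀ (v : ι → ℂ) (w : κ → ℂ),
      (∀ k, ∑ p : ι × κ, c k p * (v p.1 * w p.2) = 0) → v = 0 ∨ w = 0) :
    Fintype.card ι + Fintype.card κ - 1 ≤ Fintype.card ρ := by
  have : IsNoetherianRing (segreHom ι κ).range :=
    isNoetherianRing_of_surjective _ _ (segreHom ι κ).rangeRestrict.toRingHom
      (segreHom ι κ).rangeRestrict_surjective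
  have h := card_add_card_le_height_segreIdeal_univ.trans
    (Ideal.height_le_card_of_mem_minimalPrimes_span (Set.finite_range _)
      (segreIdeal_univ_mem_minimalPrimes c hc))
  refine (Nat.cast_le.mp h).trans ?_
  rw [← Set.image_univ, ← Nat.card_eq_fintype_card, ← Set.ncard_univ]
  exact Set.ncard_image_le Set.finite_univ

end Segre

/-- Hopf's inequality: if `φ : V × W → U` is a ℂ-bilinear map with no zero-divisors,
with `V`, `W` finite-dimensional and nonzero, then the span of the image of `φ` has
dimension at least `dim V + dim W - 1`. -/
theorem hopf_inequality {V W U : Type*}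
    [AddCommGroup V] [Module ℂ V] [AddCommGroup W] [Module ℂ W]
    [AddCommGroup U] [Module ℂ U]
    [FiniteDimensional ℂ V] [FiniteDimensional ℂ W]
    (hV : 0 < Module.finrank ℂ V) (hW : 0 < Module.finrank ℂ W)
    (φ : V →ₗ[ℂ] W →ₗ[ℂ] U)
    (hφ : ∀ v w, φ v w = 0 → v = 0 ∨ w = 0) :
    Module.finrank ℂ V + Module.finrank ℂ W - 1 ≤
      Module.finrank ℂ (Submodule.span ℂ {u : U | ∃ v w, φ v w = u}) := by
  set E := Submodule.span ℂ {u : U | ∃ v w, φ v w = u} with hE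
  have hmem : ∀ v w, φ v w ∈ E := fun v w => Submodule.subset_span ⟨v, w, rfl⟩
  let bV := Module.finBasis ℂ V
  let bW := Module.finBasis ℂ W
  have hEmap : E = Submodule.map₂ φ ⊤ ⊤ := by
    rw [Submodule.map₂_eq_span_image2, hE]
    congr 1
    ext u
    simp [Set.mem_image2]
  have : FiniteDimensional ℂ E := by
    rw [hEmap]
    exact Module.Finite.iff_fg.mpr
      (Submodule.FG.map₂ φ Module.Finite.fg_top Module.Finite.fg_top)
  let b := Module.finBasis ℂ E
  have : Nonempty (Fin (Module.finrank ℂ V)) := Fin.pos_iff_nonempty.mp hV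
  have : Nonempty (Fin (Module.finrank ℂ W)) := Fin.pos_iff_nonempty.mp hW
  have h := card_add_card_sub_one_le_of_forall_eq_zero
    (fun k (p : Fin (Module.finrank ℂ V) × Fin (Module.finrank ℂ W)) =>
      b.repr ⟨φ (bV p.1) (bW p.2), hmem _ _⟩ k) ?_
  · simpa using h
  intro v w hvw
  have hsum : ∑ p : Fin (Module.finrank ℂ V) × Fin (Module.finrank ℂ W),
      (v p.1 * w p.2) • (⟨φ (bV p.1) (bW p.2), hmem _ _⟩ : E) = 0 := by
    apply b.repr.injective
    ext k
    simp only [map_sum, map_smul, map_zero, Finsupp.finsetSum_apply, Finsupp.smul_apply,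
      smul_eq_mul, Finsupp.zero_apply]
    simpa only [mul_comm] using hvw k
  have hzero : φ (∑ i, v i • bV i) (∑ j, w j • bW j) = 0 := by
    have := congrArg E.subtype hsum
    rw [LinearMap.map_sum₂]
    simpa [Fintype.sum_prod_type, Finset.smul_sum, smul_smul, mul_comm] using this
  refine (hφ _ _ hzero).imp (fun h => ?_) fun h => ?_
  · exact funext (Fintype.linearIndependent_iff.mp bV.linearIndependent v h)
  · exact funext (Fintype.linearIndependent_iff.mp bW.linearIndependent w h)
end

section
/- Let R be a commutative ring that is an integral domain and a ℂ-algebra, and let V, W ⊆ R be nonzero finite-dimensional ℂ-linear subspaces. Then the ℂ-linear span of the set of products {v·w : v ∈ V, w ∈ W} has dimension at least dim V + dim W − 1. -/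
open Module in
lemma Submodule.finrank_map_mulLeft {k R : Type*} [Field k] [CommRing R] [IsDomain R]
    [Algebra k R] (V : Submodule k R) {b : R} (hb : b ≠ 0) :
    finrank k (V.map (LinearMap.mulLeft k b)) = finrank k V :=
  (Submodule.equivMapOfInjective _ (mul_right_injective₀ hb) V).finrank_eq.symm

/-- If `W * V ⊆ b * V` for a nonzero finite-dimensional space `V` over an algebraically closed
field, then `W` lies in the line spanned by `b`. -/
lemma Submodule.mem_span_singleton_of_mul_mem_map {k R : Type*} [Field k] [IsAlgClosed k]
    [CommRing R] [IsDomain R] [Algebra k R] (V : Submodule k R) [FiniteDimensional k V]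
    (hV : V ≠ ⊥) {b w : R} (hb : b ≠ 0)
    (h : ∀ a ∈ V, w * a ∈ V.map (LinearMap.mulLeft k b)) : w ∈ Submodule.span k {b} := by
  have : Nontrivial V := Submodule.nontrivial_iff_ne_bot.2 hV
  let e := Submodule.equivMapOfInjective (LinearMap.mulLeft k b) (mul_right_injective₀ hb) V
  let f : Module.End k V := e.symm.toLinearMap ∘ₗ (LinearMap.mulLeft k w).restrict h
  obtain ⟨μ, hμ⟩ := Module.End.exists_eigenvalue f
  obtain ⟨v, hv⟩ := hμ.exists_hasEigenvector
  have h1 : e (f v) = (LinearMap.mulLeft k w).restrict h v := by simp [f]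
  rw [hv.apply_eq_smul] at h1
  have h2 : b * (μ • (v : R)) = w * v := congrArg Subtype.val h1
  have hv0 : (v : R) ≠ 0 := by simpa using hv.2
  refine Submodule.mem_span_singleton.2 ⟨μ, mul_right_cancel₀ hv0 ?_⟩
  rw [← h2, smul_mul_assoc, mul_smul_comm]

open Module in
/-- **Hopf's inequality** for products of subspaces of a domain over an algebraically closed field.
The proof is a linear version of the Dyson e-transform argument. -/
theorem Submodule.finrank_add_finrank_le_finrank_mul_add_one {k R : Type*} [Field k]
    [IsAlgClosed k] [CommRing R] [IsDomain R] [Algebra k R] (V W : Submodule k R)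
    [FiniteDimensional k V] [FiniteDimensional k W] (hV : V ≠ ⊥) (hW : W ≠ ⊥) :
    finrank k V + finrank k W ≤ finrank k (V * W : Submodule k R) + 1 := by
  induction hn : finrank k W using Nat.strong_induction_on generalizing V W with
  | _ n ih =>
  subst hn
  have : FiniteDimensional k (V * W : Submodule k R) :=
    Module.Finite.iff_fg.2 ((Module.Finite.iff_fg.1 ‹_›).mul (Module.Finite.iff_fg.1 ‹_›))
  obtain ⟨b, hbW, hb⟩ := Submodule.exists_mem_ne_zero_of_ne_bot hW
  by_cases hstab : ∀ w ∈ W, ∀ a ∈ V, w * a ∈ V.map (LinearMap.mulLeft k b)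
  · have hWb : W ≤ Submodule.span k {b} := fun w hw ↦
      V.mem_span_singleton_of_mul_mem_map hV hb (hstab w hw)
    have h1 : finrank k W ≤ 1 :=
      (Submodule.finrank_mono hWb).trans (finrank_span_singleton hb).le
    have h2 : V.map (LinearMap.mulLeft k b) ≤ V * W := by
      rintro _ ⟨v, hv, rfl⟩
      rw [LinearMap.mulLeft_apply, mul_comm b v]
      exact Submodule.mul_mem_mul hv hbW
    have h3 := Submodule.finrank_mono h2
    rw [V.finrank_map_mulLeft hb] at h3
    omega
  · push Not at hstab
    obtain ⟨w, hw, a, haV, hwa⟩ := hstab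
    have ha : a ≠ 0 := by
      rintro rfl
      simp at hwa
    let bV := V.map (LinearMap.mulLeft k b)
    let aW := W.map (LinearMap.mulLeft k a)
    let V' := bV ⊔ aW
    let W' := W ⊓ bV.comap (LinearMap.mulLeft k a)
    have hbW' : b ∈ W' := ⟨hbW, a, haV, mul_comm b a⟩
    have hlt : W' < W := by
      refine lt_of_le_of_ne inf_le_left fun h ↦ hwa ?_
      rw [mul_comm]
      exact (h.ge hw).2
    have : FiniteDimensional k W' := Submodule.finiteDimensional_of_le hlt.le
    have hV' : V' ≠ ⊥ := fun h ↦
      mul_ne_zero hb ha ((Submodule.mem_bot k).1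
        (h.le (Submodule.mem_sup_left (Submodule.mem_map_of_mem haV))))
    have hW' : W' ≠ ⊥ := fun h ↦ hb ((Submodule.mem_bot k).1 (h.le hbW'))
    have key := ih _ (Submodule.finrank_lt_finrank_of_lt hlt) V' W' hV' hW' rfl
    have hmap : W'.map (LinearMap.mulLeft k a) = bV ⊓ aW := by
      rw [inf_comm]
      exact Submodule.map_inf_eq_map_inf_comap.symm
    have hdim := Submodule.finrank_sup_add_finrank_inf_eq bV aW
    rw [← hmap, W'.finrank_map_mulLeft ha, V.finrank_map_mulLeft hb,
      W.finrank_map_mulLeft ha] at hdim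
    have hmul : V' * W' ≤ (V * W).map (LinearMap.mulLeft k b) := by
      rw [Submodule.sup_mul, sup_le_iff, Submodule.mul_le, Submodule.mul_le]
      constructor
      · rintro _ ⟨v, hv, rfl⟩ u hu
        exact ⟨v * u, Submodule.mul_mem_mul hv hu.1, (mul_assoc b v u).symm⟩
      · rintro _ ⟨x, hx, rfl⟩ u ⟨-, v, hv, hvu⟩
        refine ⟨v * x, Submodule.mul_mem_mul hv hx, ?_⟩
        simp only [LinearMap.mulLeft_apply] at hvu ⊢
        linear_combination x * hvu
    have hle := Submodule.finrank_mono hmul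
    rw [(V * W).finrank_map_mulLeft hb] at hle
    change finrank k V' + _ = _ at hdim
    omega


/-- Hopf's inequality for multiplication in an integral domain which is a ℂ-algebra:
if `V`, `W` are nonzero finite-dimensional ℂ-subspaces of `R`, then the span of the
set of products `{v * w : v ∈ V, w ∈ W}` has dimension at least `dim V + dim W - 1`. -/
theorem hopf_inequality_domain {R : Type*} [CommRing R] [IsDomain R] [Algebra ℂ R]
    (V W : Submodule ℂ R)
    [FiniteDimensional ℂ V] [FiniteDimensional ℂ W]
    (hV : 0 < Module.finrank ℂ V) (hW : 0 < Module.finrank ℂ W) :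
    Module.finrank ℂ V + Module.finrank ℂ W - 1 ≤
      Module.finrank ℂ
        (Submodule.span ℂ {x : R | ∃ v ∈ V, ∃ w ∈ W, v * w = x}) := by
  have hspan : Submodule.span ℂ {x : R | ∃ v ∈ V, ∃ w ∈ W, v * w = x} = V * W :=
    (Submodule.mul_eq_span_mul_set V W).symm
  rw [hspan]
  have h := V.finrank_add_finrank_le_finrank_mul_add_one W
    (by rintro rfl; simp at hV) (by rintro rfl; simp at hW)
  omega
end

section
/- Abstract form of Lemma 2.2 (strict increase of sections): Let R be a commutative ring that is an integral domain and a ℂ-algebra, and let V ⊆ R be a finite-dimensional ℂ-linear subspace with dim V ≥ 2. Then the ℂ-linear span of the set of products {v·w : v, w ∈ V} has dimension strictly greater than 2·dim V − 2; in particular its dimension is strictly greater than dim V. -/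
open Module

/-- Multiplication by elements of `B` divided by a fixed nonzero `b ∈ B` stabilizes a nonzero
finite-dimensional subspace `A` only if `B` is the line spanned by `b`. -/
lemma le_span_singleton_of_mul_inv_mul_mem {F K : Type*} [Field F] [IsAlgClosed F] [Field K]
    [Algebra F K] {A B : Submodule F K} [FiniteDimensional F A] (hA : A ≠ ⊥)
    {b : K} (hb : b ≠ 0) (h : ∀ a ∈ A, ∀ c ∈ B, a * b⁻¹ * c ∈ A) :
    B ≤ Submodule.span F {b} := by
  intro c hc
  have : Nontrivial A := Submodule.nontrivial_iff_ne_bot.mpr hA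
  have hstable : ∀ a ∈ A, LinearMap.mulLeft F (b⁻¹ * c) a ∈ A := fun a ha => by
    have := h a ha c hc
    rwa [mul_assoc, mul_comm] at this
  obtain ⟨r, hr⟩ := End.exists_eigenvalue ((LinearMap.mulLeft F (b⁻¹ * c)).restrict hstable)
  obtain ⟨v, hv⟩ := hr.exists_hasEigenvector
  have hv0 : (v : K) ≠ 0 := fun h0 => hv.2 (Subtype.ext h0)
  have hmul : b⁻¹ * c * (v : K) = r • (v : K) := congrArg Subtype.val hv.apply_eq_smul
  have hc_eq : b⁻¹ * c = algebraMap F K r :=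
    mul_right_cancel₀ hv0 (hmul.trans (Algebra.smul_def _ _))
  refine Submodule.mem_span_singleton.mpr ⟨r, ?_⟩
  rw [Algebra.smul_def, ← hc_eq]
  field_simp

/-- The linear Dyson transform preserves the sum of the dimensions. -/
lemma finrank_dyson_transform {F K : Type*} [Field F] [Field K] [Algebra F K]
    (A B : Submodule F K) [FiniteDimensional F A] [FiniteDimensional F B] {e : K} (he : e ≠ 0) :
    finrank F ↥(A ⊔ B.map (LinearMap.mulLeft F e)) +
      finrank F ↥(B ⊓ A.comap (LinearMap.mulLeft F e)) = finrank F A + finrank F B := by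
  have hinj : Function.Injective (LinearMap.mulLeft F e) := fun x y h => mul_left_cancel₀ he h
  rw [(Submodule.equivMapOfInjective _ hinj (B ⊓ A.comap _)).finrank_eq,
    (Submodule.equivMapOfInjective _ hinj B).finrank_eq,
    ← Submodule.map_inf_eq_map_inf_comap, inf_comm (B.map _) A,
    Submodule.finrank_sup_add_finrank_inf_eq]

/-- The linear Dyson transform does not enlarge the product. -/
lemma dyson_transform_mul_le {F K : Type*} [Field F] [Field K] [Algebra F K]
    (A B : Submodule F K) (e : K) :
    (A ⊔ B.map (LinearMap.mulLeft F e)) * (B ⊓ A.comap (LinearMap.mulLeft F e)) ≤ A * B := by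
  rw [Submodule.sup_mul]
  refine sup_le (mul_le_mul_right inf_le_left _) (Submodule.mul_le.mpr ?_)
  rintro _ ⟨x, hx, rfl⟩ y ⟨-, hy⟩
  rw [LinearMap.mulLeft_apply, mul_right_comm]
  exact Submodule.mul_mem_mul hy hx

/-- A linear Cauchy–Davenport inequality over an algebraically closed field. -/
theorem finrank_add_finrank_le_finrank_mul_add_one {F K : Type*} [Field F] [IsAlgClosed F]
    [Field K] [Algebra F K] (A B : Submodule F K) [FiniteDimensional F A] [FiniteDimensional F B]
    (hA : A ≠ ⊥) (hB : B ≠ ⊥) :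
    finrank F A + finrank F B ≤ finrank F ↥(A * B) + 1 := by
  induction hn : finrank F B using Nat.strong_induction_on generalizing A B with
  | _ n ih =>
  subst hn
  obtain ⟨b, hb, hb0⟩ := B.ne_bot_iff.mp hB
  have hfin : FiniteDimensional F ↥(A * B) :=
    Module.Finite.iff_fg.mpr ((Module.Finite.iff_fg.mp ‹_›).mul (Module.Finite.iff_fg.mp ‹_›))
  by_cases h : ∀ a ∈ A, ∀ c ∈ B, a * b⁻¹ * c ∈ A
  · have hB1 : finrank F B ≤ 1 :=
      (Submodule.finrank_mono (le_span_singleton_of_mul_inv_mul_mem hA hb0 h)).trans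
        (finrank_span_le_card _ |>.trans (by simp))
    have hinj : Function.Injective (LinearMap.mulLeft F b) := fun x y h => mul_left_cancel₀ hb0 h
    have hAB : finrank F A ≤ finrank F ↥(A * B) := by
      rw [(Submodule.equivMapOfInjective _ hinj A).finrank_eq]
      refine Submodule.finrank_mono ?_
      rintro _ ⟨a, ha, rfl⟩
      rw [LinearMap.mulLeft_apply, mul_comm b]
      exact Submodule.mul_mem_mul ha hb
    lia
  · push Not at h
    obtain ⟨a, ha, c, hc, hac⟩ := h
    have ha0 : a ≠ 0 := by
      rintro rfl
      simp at hac
    have he : a * b⁻¹ ≠ 0 := mul_ne_zero ha0 (inv_ne_zero hb0)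
    have hlt : B ⊓ A.comap (LinearMap.mulLeft F (a * b⁻¹)) < B :=
      inf_lt_left.mpr fun hle => hac (hle hc)
    have hne : B ⊓ A.comap (LinearMap.mulLeft F (a * b⁻¹)) ≠ ⊥ :=
      (Submodule.ne_bot_iff _).mpr ⟨b, ⟨hb, by simpa [hb0] using ha⟩, hb0⟩
    have hfin' := Submodule.finiteDimensional_of_le hlt.le
    have hind := ih _ (Submodule.finrank_lt_finrank_of_lt hlt) _ _
      (ne_bot_of_le_ne_bot hA (le_sup_left (b := B.map (LinearMap.mulLeft F (a * b⁻¹))))) hne rfl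
    have hmono := Submodule.finrank_mono (dyson_transform_mul_le A B (a * b⁻¹))
    have hsum := finrank_dyson_transform A B he
    lia

/-- Abstract form of Lemma 2.2: if `V` is a ℂ-subspace of an integral domain `R`
(which is a ℂ-algebra) with `dim V ≥ 2`, then the span of the set of products
`{v * w : v, w ∈ V}` has dimension strictly greater than `2 * dim V - 2`, and in
particular strictly greater than `dim V`. -/
theorem sections_strict_increase {R : Type*} [CommRing R] [IsDomain R] [Algebra ℂ R]
    (V : Submodule ℂ R) [FiniteDimensional ℂ V]
    (hV : 2 ≤ Module.finrank ℂ V) :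
    2 * Module.finrank ℂ V - 2 <
      Module.finrank ℂ
        (Submodule.span ℂ {x : R | ∃ v ∈ V, ∃ w ∈ V, v * w = x}) ∧
    Module.finrank ℂ V <
      Module.finrank ℂ
        (Submodule.span ℂ {x : R | ∃ v ∈ V, ∃ w ∈ V, v * w = x}) := by
  have hspan : Submodule.span ℂ {x : R | ∃ v ∈ V, ∃ w ∈ V, v * w = x} = V * V :=
    (Submodule.mul_eq_span_mul_set V V).symm
  rw [hspan]
  let f : R →ₐ[ℂ] FractionRing R := IsScalarTower.toAlgHom ℂ R (FractionRing R)
  have hinj : Function.Injective f.toLinearMap := IsFractionRing.injective R (FractionRing R)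
  have hfinrank (W : Submodule ℂ R) : finrank ℂ ↥(W.map f.toLinearMap) = finrank ℂ W :=
    (Submodule.equivMapOfInjective _ hinj W).finrank_eq.symm
  have hne : V.map f.toLinearMap ≠ ⊥ := by
    intro h
    have := hfinrank V
    rw [h, finrank_bot] at this
    lia
  have key := finrank_add_finrank_le_finrank_mul_add_one _ _ hne hne
  rw [← Submodule.map_mul, hfinrank, hfinrank] at key
  lia
end
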